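/- arXiv:math/0204235 — 9 statements merged into one kernel-verified Lean document; each statement's English description precedes it below -/
import Mathlib

section
/- Let k be a field of characteristic different from 3. The map L : k⁶ → Mat₃ₓ₂(k) sending (A,B,C,D,z,w) to the Miranda matrix M(A,B,C,D,z,w) = [[z+A, B], [C, w+D], [w−2D, z−2A]] is a linear bijection (a linear equivalence of k-vector spaces), and it maps the set 𝒳 = {(A,B,C,D,z,w) ∈ k⁶ : the three Miranda quadrics hold} bijectively onto the set of 3×2 matrices over k of rank at most 1. -/
/-- The Miranda matrix associated to a point `(A,B,C,D,z,w)` of `k⁶`. -/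
def mirandaMatrix {k : Type*} [Field k] (p : Fin 6 → k) :
    Matrix (Fin 3) (Fin 2) k :=
  !![p 4 + p 0, p 1; p 2, p 5 + p 3; p 5 - 2 * p 3, p 4 - 2 * p 0]

/-- The common zero locus `𝒳 ⊆ k⁶` of the three Miranda quadrics, in
coordinates `(A,B,C,D,z,w) = (p 0, p 1, p 2, p 3, p 4, p 5)`. -/
def mirandaVariety (k : Type*) [Field k] : Set (Fin 6 → k) :=
  {p | p 4 ^ 2 = p 0 * p 4 + p 1 * p 5 + 2 * (p 0 ^ 2 - p 1 * p 3) ∧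
       p 4 * p 5 = -(p 3 * p 4) - p 0 * p 5 + (p 1 * p 2 - p 0 * p 3) ∧
       p 5 ^ 2 = p 2 * p 4 + p 3 * p 5 + 2 * (p 3 ^ 2 - p 0 * p 2)}

/-- A matrix over a field has rank at most one iff all its `2 × 2` minors vanish. -/
theorem Matrix.rank_le_one_iff_minors {m n k : Type*} [Fintype m] [Fintype n] [Field k]
    (M : Matrix m n k) :
    M.rank ≤ 1 ↔ ∀ i i' j j', M i j * M i' j' = M i j' * M i' j := by
  classical
  constructor
  · intro h i i' j j'
    obtain ⟨v, hv⟩ := finrank_le_one_iff.mp (show Module.finrank k M.mulVecLin.range ≤ 1 from h)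
    have key (j : n) : ∃ c : k, ∀ i, M i j = c * v.1 i := by
      obtain ⟨c, hc⟩ := hv ⟨M.mulVecLin (Pi.single j 1), LinearMap.mem_range_self _ _⟩
      refine ⟨c, fun i => ?_⟩
      have := congrFun (congrArg Subtype.val hc) i
      simpa [Matrix.mulVecLin_apply] using this.symm
    obtain ⟨c, hc⟩ := key j
    obtain ⟨d, hd⟩ := key j'
    rw [hc, hd, hc, hd]
    ring
  · intro h
    by_cases hM : M = 0
    · simp [hM]
    · obtain ⟨i, j, hij⟩ : ∃ i j, M i j ≠ 0 := by
        by_contra! h0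
        exact hM (Matrix.ext h0)
      have hM' : M = Matrix.vecMulVec (fun i' => M i' j) (fun j' => M i j' / M i j) := by
        ext i' j'
        rw [Matrix.vecMulVec_apply]
        field_simp
        linear_combination h i i' j j'
      rw [hM']
      exact Matrix.rank_vecMulVec_le _ _

/-- The Miranda variety is the locus where the Miranda matrix has rank at most one. -/
theorem mem_mirandaVariety_iff {k : Type*} [Field k] (p : Fin 6 → k) :
    p ∈ mirandaVariety k ↔ (mirandaMatrix p).rank ≤ 1 := by
  rw [Matrix.rank_le_one_iff_minors]
  constructor
  · rintro ⟨h₁, h₂, h₃⟩ i i' j j'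
    fin_cases i <;> fin_cases i' <;> fin_cases j <;> fin_cases j' <;>
      simp [mirandaMatrix] <;> grind
  · intro h
    have h₁ := h 0 2 0 1
    have h₂ := h 0 1 0 1
    have h₃ := h 1 2 0 1
    simp [mirandaMatrix] at h₁ h₂ h₃
    refine ⟨?_, ?_, ?_⟩
    · linear_combination h₁
    · linear_combination h₂
    · linear_combination -h₃

/-- The Miranda matrix, as a linear equivalence, over a field in which `3` is invertible. -/
def mirandaEquiv {k : Type*} [Field k] (h3 : (3 : k) ≠ 0) :
    (Fin 6 → k) ≃ₗ[k] Matrix (Fin 3) (Fin 2) k where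
  toFun := mirandaMatrix
  map_add' p q := by
    ext i j
    fin_cases i <;> fin_cases j <;> simp [mirandaMatrix] <;> ring
  map_smul' c p := by
    ext i j
    fin_cases i <;> fin_cases j <;> simp [mirandaMatrix] <;> ring
  invFun M := ![(M 0 0 - M 2 1) / 3, M 0 1, M 1 0, (M 1 1 - M 2 0) / 3,
    (2 * M 0 0 + M 2 1) / 3, (2 * M 1 1 + M 2 0) / 3]
  left_inv p := by
    ext i
    fin_cases i <;> simp [mirandaMatrix] <;> field_simp <;> ring
  right_inv M := by
    ext i j
    fin_cases i <;> fin_cases j <;> simp [mirandaMatrix] <;> field_simp <;> ring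

/-- Over a field of characteristic ≠ 3, the map
`(A,B,C,D,z,w) ↦ M(A,B,C,D,z,w)` is a linear equivalence `k⁶ ≃ Mat₃ₓ₂(k)`
carrying the Miranda variety `𝒳` bijectively onto the set of `3×2` matrices of
rank at most `1`. -/
theorem miranda_linear_equiv_maps_variety_onto_rank_le_one
    (k : Type*) [Field k] (hchar : ringChar k ≠ 3) :
    ∃ L : (Fin 6 → k) ≃ₗ[k] Matrix (Fin 3) (Fin 2) k,
      (∀ p : Fin 6 → k, L p = mirandaMatrix p) ∧
      (⇑L) '' mirandaVariety k = {m : Matrix (Fin 3) (Fin 2) k | m.rank ≤ 1} := by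
  have h3 : (3 : k) ≠ 0 := fun h =>
    hchar ((CharP.ringChar_of_prime_eq_zero Nat.prime_three (by exact_mod_cast h)))
  refine ⟨mirandaEquiv h3, fun _ => rfl, ?_⟩
  ext M
  constructor
  · rintro ⟨p, hp, rfl⟩
    exact (mem_mirandaVariety_iff p).mp hp
  · intro hM
    obtain ⟨p, rfl⟩ := (mirandaEquiv h3).surjective M
    exact ⟨p, (mem_mirandaVariety_iff p).mpr hM, rfl⟩
end

section
/- Let k be a field, let A, B, C, D, z, w ∈ k and let (u, v) ∈ k² with (u, v) ≠ (0, 0). If the Miranda matrix M(A,B,C,D,z,w) = [[z+A, B], [C, w+D], [w−2D, z−2A]] annihilates the column vector (−v, u), i.e. −v(z+A) + uB = 0, −vC + u(w+D) = 0, and −v(w−2D) + u(z−2A) = 0, then Bu³ − 3Au²v + 3Duv² − Cv³ = 0. -/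
/-- If the Miranda matrix annihilates the nonzero column vector
`(−v, u)`, then the local cubic `Bu³ − 3Au²v + 3Duv² − Cv³` vanishes. -/
theorem miranda_annihilator_satisfies_local_cubic (k : Type*) [Field k]
    (A B C D z w u v : k) (huv : (u, v) ≠ (0, 0))
    (h1 : -v * (z + A) + u * B = 0)
    (h2 : -v * C + u * (w + D) = 0)
    (h3 : -v * (w - 2 * D) + u * (z - 2 * A) = 0) :
    B * u ^ 3 - 3 * A * u ^ 2 * v + 3 * D * u * v ^ 2 - C * v ^ 3 = 0 := by
  linear_combination u ^ 2 * h1 + v ^ 2 * h2 + u * v * h3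
end

section
/- Let k be a field, let A, B, C, D ∈ k and let (u, v) ∈ k² with (u, v) ≠ (0, 0) satisfy the local cubic Bu³ − 3Au²v + 3Duv² − Cv³ = 0. Then there exists a unique pair (z, w) ∈ k² such that the Miranda matrix M(A,B,C,D,z,w) = [[z+A, B], [C, w+D], [w−2D, z−2A]] annihilates the column vector (−v, u), i.e. −v(z+A) + uB = 0, −vC + u(w+D) = 0, and −v(w−2D) + u(z−2A) = 0. (This is the statement that the projection φ : Γ → 𝒵, forgetting the coordinates (z,w), is a bijection over k⁴.) -/
/-- Given `(A,B,C,D)` and a nonzero `(u,v)` satisfying the local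
cubic, there is a unique `(z,w)` such that the Miranda matrix
`M(A,B,C,D,z,w)` annihilates the column vector `(−v, u)`.  (The projection
`φ : Γ → 𝒵` forgetting `(z,w)` is a bijection over `k⁴`.) -/
theorem miranda_unique_lift_of_local_cubic (k : Type*) [Field k]
    (A B C D u v : k) (huv : (u, v) ≠ (0, 0))
    (hcubic : B * u ^ 3 - 3 * A * u ^ 2 * v + 3 * D * u * v ^ 2 - C * v ^ 3 = 0) :
    ∃! zw : k × k,
      -v * (zw.1 + A) + u * B = 0 ∧
      -v * C + u * (zw.2 + D) = 0 ∧
      -v * (zw.2 - 2 * D) + u * (zw.1 - 2 * A) = 0 := by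
  rcases eq_or_ne u 0 with rfl | hu
  · have hv : v ≠ 0 := by rintro rfl; exact huv rfl
    have hC : C = 0 := by simpa [hv] using hcubic
    subst hC
    refine ⟨(-A, 2 * D), ⟨by ring, by ring, by ring⟩, ?_⟩
    rintro ⟨z, w⟩ ⟨h₁, -, h₃⟩
    refine Prod.ext (mul_left_cancel₀ hv ?_) (mul_left_cancel₀ hv ?_)
    · linear_combination -h₁
    · linear_combination -h₃
  rcases eq_or_ne v 0 with rfl | hv
  · have hB : B = 0 := by simpa [hu] using hcubic
    subst hB
    refine ⟨(2 * A, -D), ⟨by ring, by ring, by ring⟩, ?_⟩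
    rintro ⟨z, w⟩ ⟨-, h₂, h₃⟩
    refine Prod.ext (mul_left_cancel₀ hu ?_) (mul_left_cancel₀ hu ?_)
    · linear_combination h₃
    · linear_combination h₂
  refine ⟨(u * B / v - A, v * C / u - D), ⟨?_, ?_, ?_⟩, ?_⟩
  · field_simp
    ring
  · field_simp
    ring
  · field_simp
    linear_combination hcubic
  rintro ⟨z, w⟩ ⟨h₁, h₂, -⟩
  refine Prod.ext (mul_left_cancel₀ hv ?_) (mul_left_cancel₀ hu ?_)
  · field_simp
    linear_combination -h₁
  · field_simp
    linear_combination h₂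
end

section
/- Let k be a field of characteristic different from 3 and let (A, B, C, D, z, w) ∈ k⁶ be a nonzero tuple satisfying the three Miranda quadrics. Then there exists a pair (u, v) ∈ k², unique up to multiplication by a nonzero scalar (i.e. a unique point [u:v] of the projective line over k), with (u, v) ≠ (0, 0) such that the Miranda matrix M(A,B,C,D,z,w) annihilates the column vector (−v, u). (This is the statement that the resolution ρ : Γ → 𝒳 is an isomorphism away from the unique fat triple ramification point of the universal local triple cover.) -/
/-- A vector orthogonal to a nonzero row `(a, b)` of a rank one matrix is unique up to scaling. -/
theorem exists_scalar_of_proportional {k : Type*} [Field k] {a b u v : k}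
    (hab : a ≠ 0 ∨ b ≠ 0) (huv : (u, v) ≠ (0, 0)) (h : -v * a + u * b = 0) :
    ∃ c : k, c ≠ 0 ∧ u = c * a ∧ v = c * b := by
  have hva : v * a = u * b := by linear_combination -h
  rcases hab with ha | hb
  · have hu : u ≠ 0 := by
      rintro rfl
      simp_all
    exact ⟨u / a, div_ne_zero hu ha, by field_simp, by field_simp; exact hva⟩
  · have hv : v ≠ 0 := by
      rintro rfl
      simp_all
    exact ⟨v / b, div_ne_zero hv hb, by field_simp; exact hva.symm, by field_simp⟩

/-- A nonzero `3 × 2` matrix with vanishing minors has a one-dimensional kernel. -/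
theorem exists_unique_kernel_of_minors {k : Type*} [Field k] {a₁ b₁ a₂ b₂ a₃ b₃ : k}
    (h12 : a₁ * b₂ = a₂ * b₁) (h13 : a₁ * b₃ = a₃ * b₁) (h23 : a₂ * b₃ = a₃ * b₂)
    (hne : (a₁ ≠ 0 ∨ b₁ ≠ 0) ∨ (a₂ ≠ 0 ∨ b₂ ≠ 0) ∨ (a₃ ≠ 0 ∨ b₃ ≠ 0)) :
    ∃ u v : k, (u, v) ≠ (0, 0) ∧
      (-v * a₁ + u * b₁ = 0 ∧ -v * a₂ + u * b₂ = 0 ∧ -v * a₃ + u * b₃ = 0) ∧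
      ∀ u' v' : k, (u', v') ≠ (0, 0) →
        (-v' * a₁ + u' * b₁ = 0 ∧ -v' * a₂ + u' * b₂ = 0 ∧ -v' * a₃ + u' * b₃ = 0) →
        ∃ c : k, c ≠ 0 ∧ u' = c * u ∧ v' = c * v := by
  have pair_ne {a b : k} (h : a ≠ 0 ∨ b ≠ 0) : (a, b) ≠ (0, 0) := by
    rw [ne_eq, Prod.mk.injEq]
    tauto
  rcases hne with h | h | h
  · refine ⟨a₁, b₁, pair_ne h, ⟨?_, ?_, ?_⟩,
      fun u v huv hk ↦ exists_scalar_of_proportional h huv hk.1⟩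
    · ring
    · linear_combination h12
    · linear_combination h13
  · refine ⟨a₂, b₂, pair_ne h, ⟨?_, ?_, ?_⟩,
      fun u v huv hk ↦ exists_scalar_of_proportional h huv hk.2.1⟩
    · linear_combination -h12
    · ring
    · linear_combination h23
  · refine ⟨a₃, b₃, pair_ne h, ⟨?_, ?_, ?_⟩,
      fun u v huv hk ↦ exists_scalar_of_proportional h huv hk.2.2⟩
    · linear_combination -h13
    · linear_combination -h23
    · ring

/-- In a field whose characteristic is not `3`, the element `3` is nonzero. -/
theorem three_ne_zero_of_ringChar_ne_three {k : Type*} [Field k] (h : ringChar k ≠ 3) :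
    (3 : k) ≠ 0 := by
  intro h3
  have hdvd : ringChar k ∣ 3 := (ringChar.spec k 3).mp (by exact_mod_cast h3)
  rcases (Nat.dvd_prime Nat.prime_three).mp hdvd with h' | h'
  · exact CharP.ringChar_ne_one h'
  · exact h h'


/-- For a nonzero point `(A,B,C,D,z,w)` of the Miranda variety
over a field of characteristic ≠ 3, there is a nonzero `(u,v)`, unique up to a
nonzero scalar, such that the Miranda matrix annihilates `(−v, u)`.  (The
resolution `ρ : Γ → 𝒳` is an isomorphism away from the fat point.) -/
theorem miranda_resolution_iso_away_from_fat_point (k : Type*) [Field k]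
    (hchar : ringChar k ≠ 3) (A B C D z w : k)
    (hne : (A, B, C, D, z, w) ≠ (0, 0, 0, 0, 0, 0))
    (h1 : z ^ 2 = A * z + B * w + 2 * (A ^ 2 - B * D))
    (h2 : z * w = -(D * z) - A * w + (B * C - A * D))
    (h3 : w ^ 2 = C * z + D * w + 2 * (D ^ 2 - A * C)) :
    ∃ u v : k, (u, v) ≠ (0, 0) ∧
      (-v * (z + A) + u * B = 0 ∧
       -v * C + u * (w + D) = 0 ∧
       -v * (w - 2 * D) + u * (z - 2 * A) = 0) ∧
      ∀ u' v' : k, (u', v') ≠ (0, 0) →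
        (-v' * (z + A) + u' * B = 0 ∧
         -v' * C + u' * (w + D) = 0 ∧
         -v' * (w - 2 * D) + u' * (z - 2 * A) = 0) →
        ∃ c : k, c ≠ 0 ∧ u' = c * u ∧ v' = c * v := by
  refine exists_unique_kernel_of_minors (by linear_combination h2) (by linear_combination h1)
    (by linear_combination -h3) ?_
  have h30 := three_ne_zero_of_ringChar_ne_three hchar
  by_contra! hzero
  obtain ⟨⟨hzA, hB⟩, ⟨hC, hwD⟩, hw2D, hz2A⟩ := hzero
  have hA : A = 0 := (mul_eq_zero.mp (by linear_combination hzA - hz2A : 3 * A = 0)).resolve_left h30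
  have hD : D = 0 := (mul_eq_zero.mp (by linear_combination hwD - hw2D : 3 * D = 0)).resolve_left h30
  subst hA hD
  simp_all
end

section
/- Let k be a field, let a, b, c, d ∈ k, and let (z₁, w₁), (z₂, w₂), (z₃, w₃) ∈ k² satisfy zᵢ² = a zᵢ + b wᵢ + 2(a² − bd) for i = 1, 2, 3, together with the trace conditions z₁ + z₂ + z₃ = 0 and w₁ + w₂ + w₃ = 0. Then (z₁ + a)(z₃ − z₂) = −b(w₃ − w₂). (This identity shows that the rational map ψ, sending a point of a fibre of the triple cover to the line through the other two points of that fibre, is given in local coordinates by ψ(z, w) = [z + a : b].) -/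
/-- If the three points `(zᵢ, wᵢ)` of a fibre satisfy the first
Miranda quadric and the trace conditions `∑zᵢ = 0`, `∑wᵢ = 0`, then
`(z₁ + a)(z₃ − z₂) = −b(w₃ − w₂)`: the map `ψ` is `(z,w) ↦ [z + a : b]` in
local coordinates. -/
theorem psi_first_local_expression (k : Type*) [Field k]
    (a b c d z₁ w₁ z₂ w₂ z₃ w₃ : k)
    (h1 : z₁ ^ 2 = a * z₁ + b * w₁ + 2 * (a ^ 2 - b * d))
    (h2 : z₂ ^ 2 = a * z₂ + b * w₂ + 2 * (a ^ 2 - b * d))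
    (h3 : z₃ ^ 2 = a * z₃ + b * w₃ + 2 * (a ^ 2 - b * d))
    (hz : z₁ + z₂ + z₃ = 0) (hw : w₁ + w₂ + w₃ = 0) :
    (z₁ + a) * (z₃ - z₂) = -b * (w₃ - w₂) := by
  linear_combination (z₃ - z₂) * hz - h3 + h2
end

section
/- Let k be a field, let a, b, c, d ∈ k, and let (z₁, w₁), (z₂, w₂), (z₃, w₃) ∈ k² satisfy wᵢ² = c zᵢ + d wᵢ + 2(d² − ac) for i = 1, 2, 3, together with the trace conditions z₁ + z₂ + z₃ = 0 and w₁ + w₂ + w₃ = 0. Then (w₁ + d)(w₃ − w₂) = −c(z₃ − z₂). (This identity shows that the rational map ψ is given in local coordinates by ψ(z, w) = [c : w + d].) -/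
/-- If the three points `(zᵢ, wᵢ)` of a fibre satisfy the third
Miranda quadric and the trace conditions `∑zᵢ = 0`, `∑wᵢ = 0`, then
`(w₁ + d)(w₃ − w₂) = −c(z₃ − z₂)`: the map `ψ` is `(z,w) ↦ [c : w + d]` in
local coordinates. -/
theorem psi_second_local_expression (k : Type*) [Field k]
    (a b c d z₁ w₁ z₂ w₂ z₃ w₃ : k)
    (h1 : w₁ ^ 2 = c * z₁ + d * w₁ + 2 * (d ^ 2 - a * c))
    (h2 : w₂ ^ 2 = c * z₂ + d * w₂ + 2 * (d ^ 2 - a * c))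
    (h3 : w₃ ^ 2 = c * z₃ + d * w₃ + 2 * (d ^ 2 - a * c))
    (hz : z₁ + z₂ + z₃ = 0) (hw : w₁ + w₂ + w₃ = 0) :
    (w₁ + d) * (w₃ - w₂) = -c * (z₃ - z₂) := by
  linear_combination (w₃ - w₂) * hw - h3 + h2
end

section
/- Let k be a field, let a, b, c, d ∈ k, and let (z₁, w₁), (z₂, w₂), (z₃, w₃) ∈ k² satisfy zᵢwᵢ = −d zᵢ − a wᵢ + (bc − ad) for i = 1, 2, 3, together with the trace conditions z₁ + z₂ + z₃ = 0 and w₁ + w₂ + w₃ = 0. Then (w₁ − 2d)(z₃ − z₂) + (z₁ − 2a)(w₃ − w₂) = 0. (This identity shows that the rational map ψ is given in local coordinates by ψ(z, w) = [w − 2d : z − 2a].) -/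
/-- If the three points `(zᵢ, wᵢ)` of a fibre satisfy the middle
Miranda quadric and the trace conditions `∑zᵢ = 0`, `∑wᵢ = 0`, then
`(w₁ − 2d)(z₃ − z₂) + (z₁ − 2a)(w₃ − w₂) = 0`: the map `ψ` is
`(z,w) ↦ [w − 2d : z − 2a]` in local coordinates. -/
theorem psi_third_local_expression (k : Type*) [Field k]
    (a b c d z₁ w₁ z₂ w₂ z₃ w₃ : k)
    (h1 : z₁ * w₁ = -(d * z₁) - a * w₁ + (b * c - a * d))
    (h2 : z₂ * w₂ = -(d * z₂) - a * w₂ + (b * c - a * d))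
    (h3 : z₃ * w₃ = -(d * z₃) - a * w₃ + (b * c - a * d))
    (hz : z₁ + z₂ + z₃ = 0) (hw : w₁ + w₂ + w₃ = 0) :
    (w₁ - 2 * d) * (z₃ - z₂) + (z₁ - 2 * a) * (w₃ - w₂) = 0 := by
  linear_combination (z₃ - z₂) * hw + (w₃ - w₂) * hz - 2 * h3 + 2 * h2
end

section
/- Let k be a field, let a, b, c, d ∈ k, and let (z₁, w₁), (z₂, w₂), (z₃, w₃) ∈ k² all satisfy the three Miranda quadrics z² = az + bw + 2(a² − bd), zw = −dz − aw + (bc − ad), w² = cz + dw + 2(d² − ac), together with the trace conditions z₁ + z₂ + z₃ = 0 and w₁ + w₂ + w₃ = 0. Set u = −(w₃ − w₂) and v = z₃ − z₂. Then b u³ − 3a u²v + 3d uv² − c v³ = 0. (This is the statement that the image of the rational map ψ is contained in the cubic divisor 𝒵 ⊆ ℙ(E*) defined by the section σ describing the triple cover.) -/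
/-- If the three points `(zᵢ, wᵢ)` of a fibre satisfy all three
Miranda quadrics and the trace conditions, then `u = −(w₃ − w₂)`,
`v = z₃ − z₂` satisfy the local cubic `bu³ − 3au²v + 3duv² − cv³ = 0`: the
image of `ψ` lies in the cubic divisor `𝒵 ⊆ ℙ(E*)`. -/
theorem psi_image_in_cubic (k : Type*) [Field k]
    (a b c d z₁ w₁ z₂ w₂ z₃ w₃ : k)
    (hq1 : ∀ zw : k × k, zw = (z₁, w₁) ∨ zw = (z₂, w₂) ∨ zw = (z₃, w₃) →
      zw.1 ^ 2 = a * zw.1 + b * zw.2 + 2 * (a ^ 2 - b * d) ∧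
      zw.1 * zw.2 = -(d * zw.1) - a * zw.2 + (b * c - a * d) ∧
      zw.2 ^ 2 = c * zw.1 + d * zw.2 + 2 * (d ^ 2 - a * c))
    (hz : z₁ + z₂ + z₃ = 0) (hw : w₁ + w₂ + w₃ = 0) :
    b * (-(w₃ - w₂)) ^ 3 - 3 * a * (-(w₃ - w₂)) ^ 2 * (z₃ - z₂) +
      3 * d * (-(w₃ - w₂)) * (z₃ - z₂) ^ 2 - c * (z₃ - z₂) ^ 3 = 0 := by
  obtain ⟨hzz₂, hzw₂, hww₂⟩ := hq1 (z₂, w₂) (by simp)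
  obtain ⟨hzz₃, hzw₃, hww₃⟩ := hq1 (z₃, w₃) (by simp)
  dsimp only at hzz₂ hzw₂ hww₂ hzz₃ hzw₃ hww₃
  have hb : b * (w₃ - w₂) = -(z₁ + a) * (z₃ - z₂) := by
    linear_combination hzz₂ - hzz₃ + (z₃ - z₂) * hz
  have hc : c * (z₃ - z₂) = -(w₁ + d) * (w₃ - w₂) := by
    linear_combination hww₂ - hww₃ + (w₃ - w₂) * hw
  have hmixed : (z₁ - 2 * a) * (w₃ - w₂) + (w₁ - 2 * d) * (z₃ - z₂) = 0 := by
    linear_combination 2 * hzw₂ - 2 * hzw₃ + (w₃ - w₂) * hz + (z₃ - z₂) * hw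
  linear_combination -(w₃ - w₂) ^ 2 * hb - (z₃ - z₂) ^ 2 * hc +
    (w₃ - w₂) * (z₃ - z₂) * hmixed
end

section
/- Let R be a commutative ring and let a, b, c, d, z, w ∈ R satisfy the three Miranda quadrics z² = az + bw + 2(a² − bd), zw = −dz − aw + (bc − ad), w² = cz + dw + 2(d² − ac). Then b(z+a)³ − 3a(z+a)²b + 3d(z+a)b² − cb³ = 0, i.e. the point with homogeneous coordinates (u, v) = (z+a, b) satisfies the local cubic bu³ − 3au²v + 3duv² − cv³ = 0. (This is the single-point form of the statement that the image of the rational map ψ(z, w) = [z + a : b] lies in the cubic 𝒵.) -/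
/-- If `(z, w)` satisfies the three Miranda quadrics over a
commutative ring, then the point `(u, v) = (z + a, b)` satisfies the local
cubic `bu³ − 3au²v + 3duv² − cv³ = 0`: the image of `ψ(z,w) = [z + a : b]`
lies in the cubic `𝒵`. -/
theorem psi_point_satisfies_local_cubic (R : Type*) [CommRing R]
    (a b c d z w : R)
    (h1 : z ^ 2 = a * z + b * w + 2 * (a ^ 2 - b * d))
    (h2 : z * w = -(d * z) - a * w + (b * c - a * d))
    (h3 : w ^ 2 = c * z + d * w + 2 * (d ^ 2 - a * c)) :
    b * (z + a) ^ 3 - 3 * a * (z + a) ^ 2 * b + 3 * d * (z + a) * b ^ 2 -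
      c * b ^ 3 = 0 := by
  linear_combination b * (z + a) * h1 + b ^ 2 * h2
end
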